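/- arXiv:1601.07012 — 2 statements merged into one kernel-verified Lean document; each statement's English description precedes it below -/
import Mathlib

section
/- For all integers p, q with 2 ≤ p ≤ q, the graph K_{p,q}^- is determined by its spectrum: every finite simple graph cospectral with K_{p,q}^- is isomorphic to K_{p,q}^-. -/
open SimpleGraph Polynomial Matrix

universe u

/-- The graph `K_{p,q}⁻`, obtained from the complete bipartite graph `K_{p,q}`
by deleting one edge (the edge between the first vertex of each part). -/
def KpqMinus (p q : ℕ) : SimpleGraph (Fin p ⊕ Fin q) :=
  SimpleGraph.fromRel fun u v =>
    ∃ (i : Fin p) (j : Fin q), u = Sum.inl i ∧ v = Sum.inr j ∧ ¬(i.val = 0 ∧ j.val = 0)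

/-- The graph `K_{p,q}⁺`, obtained from the complete bipartite graph `K_{p,q}`
by adding a new vertex `x` together with a new edge `xy`, where `y` is a vertex
in the partite set of order `p`. -/
def KpqPlus (p q : ℕ) : SimpleGraph ((Fin p ⊕ Fin q) ⊕ Unit) :=
  SimpleGraph.fromRel fun u v =>
    (∃ (i : Fin p) (j : Fin q), u = Sum.inl (Sum.inl i) ∧ v = Sum.inl (Sum.inr j)) ∨
    (∃ i : Fin p, i.val = 0 ∧ u = Sum.inl (Sum.inl i) ∧ v = Sum.inr ())

/-- The disjoint union of a graph `G` with `m` isolated vertices. -/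
def addIsolated {V : Type*} (G : SimpleGraph V) (m : ℕ) : SimpleGraph (V ⊕ Fin m) :=
  SimpleGraph.fromRel fun u v => ∃ a b, u = Sum.inl a ∧ v = Sum.inl b ∧ G.Adj a b

open scoped Classical in
/-- The real adjacency matrix of a finite simple graph. -/
noncomputable def adjMat {V : Type*} [Fintype V] [DecidableEq V] (G : SimpleGraph V) :
    Matrix V V ℝ :=
  Matrix.of fun i j => if G.Adj i j then (1 : ℝ) else 0

/-- Two finite simple graphs are cospectral if their adjacency matrices have the same
characteristic polynomial. -/
def Cospectral {V W : Type*} [Fintype V] [DecidableEq V] [Fintype W] [DecidableEq W]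
    (G : SimpleGraph V) (H : SimpleGraph W) : Prop :=
  (adjMat G).charpoly = (adjMat H).charpoly

/-- A finite simple graph is determined by its spectrum (DS) if every graph cospectral
with it is isomorphic to it. -/
def IsDS {V : Type*} [Fintype V] [DecidableEq V] (G : SimpleGraph V) : Prop :=
  ∀ (W : Type u) [Fintype W] [DecidableEq W] (H : SimpleGraph W),
    Cospectral G H → Nonempty (G ≃g H)

/-- The spectral radius of a finite simple graph: the largest eigenvalue of its
adjacency matrix. -/
noncomputable def specRadius {V : Type*} [Fintype V] [DecidableEq V]
    (G : SimpleGraph V) : ℝ :=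
  sSup {x : ℝ | ∃ v : V → ℝ, v ≠ 0 ∧ (adjMat G).mulVec v = x • v}

/-- A graph is bipartite if its vertex set can be partitioned into two parts such that
every edge joins a vertex of one part to a vertex of the other. -/
def IsBipartite {V : Type*} (G : SimpleGraph V) : Prop :=
  ∃ s : Set V, ∀ a b, G.Adj a b → (a ∈ s ∧ b ∉ s) ∨ (a ∉ s ∧ b ∈ s)

/-- The path `0 - 3 - 2 - 4 - 1` on five vertices, together with the isolated vertex `5`. -/
def pathFiveIsolated : SimpleGraph (Fin 6) where
  Adj i j := (i, j) ∈ [((0 : Fin 6), (3 : Fin 6)), (3, 0), (2, 3), (3, 2), (2, 4), (4, 2),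
    (1, 4), (4, 1)]
  symm := ⟨by decide⟩
  loopless := ⟨by decide⟩

instance : DecidableRel pathFiveIsolated.Adj := fun i j =>
  inferInstanceAs (Decidable ((i, j) ∈ _))

section Spectral

variable {V : Type*} [Fintype V] [DecidableEq V]

lemma adjMat_isHermitian (G : SimpleGraph V) : (adjMat G).IsHermitian := by
  ext i j
  by_cases h : G.Adj i j <;> simp [adjMat, h, G.adj_comm j i]

lemma Matrix.IsHermitian.trace_pow_eq_sum_roots {A : Matrix V V ℝ} (hA : A.IsHermitian) (k : ℕ) :
    (A ^ k).trace = (A.charpoly.roots.map (· ^ k)).sum := by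
  have h : (A ^ k).trace = ∑ i, hA.eigenvalues i ^ k := by
    conv_lhs => rw [hA.spectral_theorem, ← map_pow, Unitary.conjStarAlgAut_apply,
      trace_mul_cycle, Unitary.coe_star_mul_self, one_mul]
    simp [diagonal_pow, trace_diagonal]
  rw [h, hA.roots_charpoly_eq_eigenvalues]
  simp

lemma Matrix.IsHermitian.rank_eq_card_roots {A : Matrix V V ℝ} (hA : A.IsHermitian) :
    A.rank = (A.charpoly.roots.filter (· ≠ 0)).card := by
  rw [hA.rank_eq_card_non_zero_eigs, hA.roots_charpoly_eq_eigenvalues, Multiset.filter_map,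
    Multiset.card_map, Fintype.card_subtype]
  rfl

lemma colorable_two_iff_trace_adjMat_pow (G : SimpleGraph V) :
    G.Colorable 2 ↔ ∀ k, Odd k → (adjMat G ^ k).trace = 0 := by
  classical
  have hA : adjMat G = G.adjMatrix ℝ := by
    ext i j
    simp [adjMat, adjMatrix_apply]
  rw [two_colorable_iff_forall_loop_even]
  simp only [hA, Matrix.trace, Matrix.diag, adjMatrix_pow_apply_eq_card_walk]
  constructor
  · intro h k hk
    refine Finset.sum_eq_zero fun u _ => ?_
    rw [Nat.cast_eq_zero, Fintype.card_eq_zero_iff]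
    exact ⟨fun w => Nat.not_even_iff_odd.2 hk (w.2 ▸ h u w.1)⟩
  · intro h u w
    by_contra hw
    have h0 := h _ (Nat.not_even_iff_odd.1 hw)
    rw [Finset.sum_eq_zero_iff_of_nonneg fun _ _ => Nat.cast_nonneg _] at h0
    have h1 := h0 u (Finset.mem_univ u)
    rw [Nat.cast_eq_zero, Fintype.card_eq_zero_iff] at h1
    exact h1.false ⟨w, rfl⟩

end Spectral

section Blowup

variable {V ι : Type*} [Fintype V] [DecidableEq V] [Fintype ι] [DecidableEq ι]

lemma Matrix.trace_mul_pow_comm {R : Type*} [CommRing R] (X : Matrix V ι R) (Y : Matrix ι V R)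
    (k : ℕ) : ((X * Y) ^ (k + 1)).trace = ((Y * X) ^ (k + 1)).trace := by
  have h : (X * Y) ^ (k + 1) = X * ((Y * X) ^ k * Y) := by
    induction k with
    | zero => simp
    | succ k ih => rw [pow_succ, ih, pow_succ]; simp only [Matrix.mul_assoc]
  rw [h, trace_mul_comm, Matrix.mul_assoc, ← pow_succ]

/-- The powers of the adjacency matrix of a blow-up have the same traces as those of the
quotient matrix. -/
lemma trace_submatrix_pow (M : Matrix ι ι ℝ) (f : V → ι) (k : ℕ) :
    ((M.submatrix f f) ^ (k + 1)).trace =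
      ((M * diagonal fun i => (Fintype.card {v // f v = i} : ℝ)) ^ (k + 1)).trace := by
  let F : Matrix V ι ℝ := Matrix.of fun v i => if f v = i then 1 else 0
  have h1 : M.submatrix f f = F * (M * Fᵀ) := by
    ext u v
    simp [F, Matrix.mul_apply]
  have h2 : M * (diagonal fun i => (Fintype.card {v // f v = i} : ℝ)) = M * Fᵀ * F := by
    rw [Matrix.mul_assoc]
    congr 1
    ext i j
    by_cases hij : i = j
    · subst hij
      simp [F, Matrix.mul_apply, Fintype.card_subtype, ← ite_and]
    · rw [diagonal_apply_ne _ hij, Matrix.mul_apply, eq_comm]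
      refine Finset.sum_eq_zero fun v _ => ?_
      by_cases hv : f v = i <;> simp [F, hv, hij]
  rw [h1, h2, Matrix.trace_mul_pow_comm]

lemma adjMat_comap (P : SimpleGraph ι) (f : V → ι) :
    adjMat (P.comap f) = (adjMat P).submatrix f f := by
  ext u v
  by_cases h : P.Adj (f u) (f v) <;> simp [adjMat, h]

lemma adjMat_pathFiveIsolated : adjMat pathFiveIsolated =
    !![0, 0, 0, 1, 0, 0; 0, 0, 0, 0, 1, 0; 0, 0, 0, 1, 1, 0; 1, 0, 1, 0, 0, 0;
      0, 1, 1, 0, 0, 0; 0, 0, 0, 0, 0, 0] := by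
  ext i j
  fin_cases i <;> fin_cases j <;> simp [adjMat, pathFiveIsolated]

lemma rank_adjMat_pathFiveIsolated : (adjMat pathFiveIsolated).rank ≤ 4 := by
  have h : adjMat pathFiveIsolated =
      (!![1, 0, 0, 0; 0, 1, 0, 0; 1, 1, 0, 0; 0, 0, 1, 0; 0, 0, 0, 1; 0, 0, 0, 0] :
        Matrix (Fin 6) (Fin 4) ℝ) *
      (!![0, 0, 0, 1, 0, 0; 0, 0, 0, 0, 1, 0; 1, 0, 1, 0, 0, 0; 0, 1, 1, 0, 0, 0] :
        Matrix (Fin 4) (Fin 6) ℝ) := by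
    rw [adjMat_pathFiveIsolated]
    ext i j
    fin_cases i <;> fin_cases j <;> simp
  rw [h]
  exact (rank_mul_le_left _ _).trans (rank_le_width _)

lemma adjMat_pathFiveIsolated_mul_diagonal (n : Fin 6 → ℝ) :
    adjMat pathFiveIsolated * diagonal n =
      !![0, 0, 0, n 3, 0, 0; 0, 0, 0, 0, n 4, 0; 0, 0, 0, n 3, n 4, 0; n 0, 0, n 2, 0, 0, 0;
        0, n 1, n 2, 0, 0, 0; 0, 0, 0, 0, 0, 0] := by
  rw [adjMat_pathFiveIsolated]
  ext i j
  rw [mul_diagonal]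
  fin_cases i <;> fin_cases j <;> simp

lemma trace_adjMat_comap_sq (f : V → Fin 6) (n : Fin 6 → ℕ)
    (hn : ∀ i, Fintype.card {v // f v = i} = n i) :
    (adjMat (pathFiveIsolated.comap f) ^ 2).trace =
      2 * (n 0 * n 3 + n 1 * n 4 + n 2 * n 3 + n 2 * n 4 : ℕ) := by
  rw [adjMat_comap, trace_submatrix_pow, adjMat_pathFiveIsolated_mul_diagonal]
  simp [pow_succ, Matrix.trace, Fin.sum_univ_succ, hn]
  ring

lemma trace_adjMat_comap_pow_four (f : V → Fin 6) (n : Fin 6 → ℕ)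
    (hn : ∀ i, Fintype.card {v // f v = i} = n i) :
    (adjMat (pathFiveIsolated.comap f) ^ 4).trace =
      2 * ((n 0 * n 3 + n 1 * n 4 + n 2 * n 3 + n 2 * n 4 : ℕ) : ℝ) ^ 2 -
        4 * ((n 0 * n 1 + n 0 * n 2 + n 1 * n 2) * (n 3 * n 4) : ℕ) := by
  rw [adjMat_comap, trace_submatrix_pow, adjMat_pathFiveIsolated_mul_diagonal]
  simp [pow_succ, Matrix.trace, Fin.sum_univ_succ, hn]
  ring

end Blowup

section Structure

variable {V : Type*}

/-- A bipartite graph whose biadjacency matrix is a sum of two 0-1 matrices of rank one with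
disjoint column supports is a blow-up of a subgraph of the path on five vertices. -/
lemma exists_eq_comap_of_adj_iff (G : SimpleGraph V) (s α β γ δ : V → Prop)
    (hs : ∀ u v, G.Adj u v → (s u ↔ ¬ s v))
    (hadj : ∀ x y, s x → ¬ s y → (G.Adj x y ↔ (α x ∧ γ y) ∨ (β x ∧ δ y)))
    (hdisj : ∀ y, ¬ s y → ¬ (γ y ∧ δ y)) :
    ∃ f : V → Fin 6, G = pathFiveIsolated.comap f := by
  classical
  let f : V → Fin 6 := fun v =>
    if s v then (if α v then (if β v then 2 else 0) else if β v then 1 else 5)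
    else if γ v then 3 else if δ v then 4 else 5
  have hmain : ∀ x y, s x → ¬ s y → (G.Adj x y ↔ pathFiveIsolated.Adj (f x) (f y)) := by
    intro x y hx hy
    rw [hadj x y hx hy]
    have := hdisj y hy
    by_cases h1 : α x <;> by_cases h2 : β x <;> by_cases h3 : γ y <;> by_cases h4 : δ y <;>
      simp_all [f, pathFiveIsolated]
  refine ⟨f, ?_⟩
  ext u v
  rw [comap_adj]
  by_cases hu : s u <;> by_cases hv : s v
  · have h1 : ¬ G.Adj u v := fun h => (hs u v h).1 hu hv
    simp only [h1, false_iff, f, hu, hv, if_true]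
    split_ifs <;> decide
  · exact hmain u v hu hv
  · rw [G.adj_comm, pathFiveIsolated.adj_comm]
    exact hmain v u hv hu
  · have h1 : ¬ G.Adj u v := fun h => hu ((hs u v h).2 hv)
    simp only [h1, false_iff, f, hu, hv, if_false]
    split_ifs <;> decide

variable [Fintype V] [DecidableEq V]

lemma det_submatrix_eq_zero_of_rank_le (G : SimpleGraph V) (hr : (adjMat G).rank ≤ 4)
    (x y : Fin 3 → V) (hx : ∀ i j, ¬ G.Adj (x i) (x j)) (hy : ∀ i j, ¬ G.Adj (y i) (y j)) :
    ((adjMat G).submatrix x y).det = 0 := by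
  set B := (adjMat G).submatrix x y with hB
  have h1 : (adjMat G).submatrix (Sum.elim x y) (Sum.elim x y) = fromBlocks 0 B Bᵀ 0 := by
    ext i j
    rcases i with i | i <;> rcases j with j | j <;> simp [hB, adjMat, hx, hy]
    by_cases h : G.Adj (x j) (y i) <;> simp [h, G.adj_comm (y i)]
  by_contra hdet
  have h2 : fromBlocks 0 B Bᵀ 0 * fromBlocks 0 B Bᵀ 0 = fromBlocks (B * Bᵀ) 0 0 (Bᵀ * B) := by
    simp [fromBlocks_multiply]
  have h3 : IsUnit (fromBlocks 0 B Bᵀ 0) := by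
    rw [isUnit_iff_isUnit_det, isUnit_iff_ne_zero]
    intro h0
    have := congrArg det h2
    rw [det_mul, h0, det_fromBlocks_zero₂₁] at this
    simp [hdet] at this
  have h4 := rank_submatrix_le (adjMat G) (Sum.elim x y) (Sum.elim x y)
  rw [h1, rank_of_isUnit _ h3] at h4
  simp at h4
  omega

lemma exists_eq_comap_of_rank_le (G : SimpleGraph V) (hr : (adjMat G).rank ≤ 4)
    (hc : G.Colorable 2) : ∃ f : V → Fin 6, G = pathFiveIsolated.comap f := by
  classical
  obtain ⟨c⟩ := hc
  let s : V → Prop := fun v => c v = 0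
  have hs : ∀ u v, G.Adj u v → (s u ↔ ¬ s v) := by
    intro u v h
    have := c.valid h
    simp only [s]
    omega
  have hs' : ∀ u v, G.Adj u v → (¬ s u ↔ ¬ ¬ s v) := fun u v h => not_congr (hs u v h)
  by_cases h : ∃ x₁ x₂ y₁ y₂, s x₁ ∧ s x₂ ∧ ¬ s y₁ ∧ ¬ s y₂ ∧ G.Adj x₁ y₁ ∧ G.Adj x₂ y₂ ∧
      ¬ G.Adj x₁ y₂
  · obtain ⟨x₁, x₂, y₁, y₂, sx₁, sx₂, sy₁, sy₂, h₁₁, h₂₂, h₁₂⟩ := h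
    have key : ∀ x y, s x → ¬ s y → adjMat G x y = (adjMat G x y₁ -
        adjMat G x₂ y₁ * adjMat G x y₂) * adjMat G x₁ y + adjMat G x y₂ * adjMat G x₂ y := by
      intro x y sx sy
      have hdet : ((adjMat G).submatrix ![x₁, x₂, x] ![y₁, y₂, y]).det = 0 := by
        refine det_submatrix_eq_zero_of_rank_le G hr _ _ (fun i j hij => ?_) fun i j hij => ?_
        · have := hs _ _ hij
          fin_cases i <;> fin_cases j <;> simp [sx₁, sx₂, sx] at this
        · have := hs _ _ hij
          fin_cases i <;> fin_cases j <;> simp [sy₁, sy₂, sy] at this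
      have w₁₁ : adjMat G x₁ y₁ = 1 := by simp [adjMat, h₁₁]
      have w₁₂ : adjMat G x₁ y₂ = 0 := by simp [adjMat, h₁₂]
      have w₂₂ : adjMat G x₂ y₂ = 1 := by simp [adjMat, h₂₂]
      rw [det_fin_three] at hdet
      simp [w₁₁, w₁₂, w₂₂] at hdet
      linarith
    by_cases h₂₁ : G.Adj x₂ y₁
    · have key' : ∀ x y, s x → ¬ s y →
          ¬ (¬ G.Adj x y₁ ∧ G.Adj x y₂ ∧ G.Adj x₁ y ∧ ¬ G.Adj x₂ y) ∧
          (G.Adj x y ↔ if G.Adj x y₁ then (if G.Adj x y₂ then G.Adj x₂ y else G.Adj x₁ y)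
            else G.Adj x y₂ ∧ G.Adj x₂ y ∧ ¬ G.Adj x₁ y) := by
        intro x y sx sy
        have := key x y sx sy
        clear key
        by_cases a₁ : G.Adj x y₁ <;> by_cases a₂ : G.Adj x y₂ <;> by_cases a₃ : G.Adj x₁ y <;>
          by_cases a₄ : G.Adj x₂ y <;> by_cases a₅ : G.Adj x y <;>
            simp [adjMat, a₁, a₂, a₃, a₄, a₅, h₂₁] at this ⊢ <;> norm_num at this
      by_cases hrow : ∃ x, s x ∧ ¬ G.Adj x y₁ ∧ G.Adj x y₂
      · obtain ⟨x₀, sx₀, hx₀⟩ := hrow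
        have hcol : ∀ y, ¬ s y → G.Adj x₁ y → G.Adj x₂ y := by
          intro y sy
          have := (key' x₀ y sx₀ sy).1
          tauto
        refine exists_eq_comap_of_adj_iff G s (G.Adj · y₁) (G.Adj · y₂) (G.Adj x₁)
          (fun y => G.Adj x₂ y ∧ ¬ G.Adj x₁ y) hs (fun x y sx sy => ?_) fun y _ => by tauto
        have h1 := (key' x y sx sy).2
        have h2 := hcol y sy
        split_ifs at h1 <;> tauto
      · refine exists_eq_comap_of_adj_iff G (¬ s ·) (G.Adj x₁) (G.Adj x₂)
          (fun x => G.Adj x y₁ ∧ ¬ G.Adj x y₂) (G.Adj · y₂) hs' (fun y x sy sx => ?_)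
          fun y _ => by tauto
        rw [not_not] at sx
        rw [G.adj_comm y x]
        have h1 := (key' x y sx sy).2
        have h2 : ¬ (¬ G.Adj x y₁ ∧ G.Adj x y₂) := fun h => hrow ⟨x, sx, h⟩
        split_ifs at h1 <;> tauto
    · have key' : ∀ x y, s x → ¬ s y →
          ¬ (G.Adj x y₁ ∧ G.Adj x y₂ ∧ G.Adj x₁ y ∧ G.Adj x₂ y) ∧
          (G.Adj x y ↔ (G.Adj x y₁ ∧ G.Adj x₁ y) ∨ (G.Adj x y₂ ∧ G.Adj x₂ y)) := by
        intro x y sx sy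
        have := key x y sx sy
        clear key
        by_cases a₁ : G.Adj x y₁ <;> by_cases a₂ : G.Adj x y₂ <;> by_cases a₃ : G.Adj x₁ y <;>
          by_cases a₄ : G.Adj x₂ y <;> by_cases a₅ : G.Adj x y <;>
            simp [adjMat, a₁, a₂, a₃, a₄, a₅, h₂₁] at this ⊢ <;> norm_num at this
      by_cases hrow : ∃ x, s x ∧ G.Adj x y₁ ∧ G.Adj x y₂
      · obtain ⟨x₀, sx₀, hx₀⟩ := hrow
        refine exists_eq_comap_of_adj_iff G s (G.Adj · y₁) (G.Adj · y₂) (G.Adj x₁) (G.Adj x₂) hs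
          (fun x y sx sy => (key' x y sx sy).2) fun y sy => ?_
        have := (key' x₀ y sx₀ sy).1
        tauto
      · refine exists_eq_comap_of_adj_iff G (¬ s ·) (G.Adj x₁) (G.Adj x₂) (G.Adj · y₁)
          (G.Adj · y₂) hs' (fun y x sy sx => ?_) fun x sx hx => hrow ⟨x, not_not.1 sx, hx⟩
        rw [not_not] at sx
        rw [G.adj_comm y x, (key' x y sx sy).2]
        tauto
  · push Not at h
    by_cases he : ∃ x₁ y₁, s x₁ ∧ ¬ s y₁ ∧ G.Adj x₁ y₁
    · obtain ⟨x₁, y₁, sx₁, sy₁, h₁₁⟩ := he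
      refine exists_eq_comap_of_adj_iff G s (G.Adj · y₁) (fun _ => False) (G.Adj x₁)
        (fun _ => False) hs (fun x y sx sy => ?_) fun y _ => by tauto
      have h1 := h x x₁ y y₁ sx sx₁ sy sy₁
      have h2 := h x₁ x y₁ y sx₁ sx sy₁ sy
      have h3 := h x x₁ y₁ y sx sx₁ sy₁ sy
      tauto
    · refine exists_eq_comap_of_adj_iff G s (fun _ => False) (fun _ => False) (fun _ => False)
        (fun _ => False) hs (fun x y sx sy => ?_) fun y _ => by tauto
      have h1 : ¬ G.Adj x y := fun h => he ⟨x, y, sx, sy, h⟩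
      tauto

end Structure

lemma blowup_parameters_aux {b c d e k P Q : ℕ} (hb : b ≠ 0) (hc : c ≠ 0) (hd : d ≠ 0)
    (he : e ≠ 0) (hsum : b + c + d + e + k = P + Q + 2)
    (hedge : b * e + c * d + c * e = P * Q + P + Q) (hminor : b * c * (d * e) = P * Q) :
    k = 0 ∧ b = 1 ∧ d = 1 ∧ (c = P ∧ e = Q ∨ c = Q ∧ e = P) := by
  have hbd : k + (b - 1) + (d - 1) = 0 := by
    obtain ⟨b, rfl⟩ := Nat.exists_eq_succ_of_ne_zero hb
    obtain ⟨c, rfl⟩ := Nat.exists_eq_succ_of_ne_zero hc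
    obtain ⟨d, rfl⟩ := Nat.exists_eq_succ_of_ne_zero hd
    obtain ⟨e, rfl⟩ := Nat.exists_eq_succ_of_ne_zero he
    simp only [Nat.succ_eq_add_one, Nat.add_sub_cancel] at *
    ring_nf at hsum hedge hminor
    lia
  obtain rfl : k = 0 := by omega
  obtain rfl : b = 1 := by omega
  obtain rfl : d = 1 := by omega
  refine ⟨rfl, rfl, rfl, ?_⟩
  have h : ((c : ℤ) - P) * (c - Q) = 0 := by
    zify at hsum hedge hminor
    have he : (e : ℤ) = P + Q - c := by linarith
    rw [he] at hminor
    linarith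
  rcases mul_eq_zero.1 h with h | h <;> omega

/-- The parameters of a blow-up of the path on five vertices (with isolated vertices) that has as
many vertices and edges, and the same sum of squared `2 × 2` minors, as `K_{P+1,Q+1}⁻`. -/
lemma blowup_parameters {a b c d e k P Q : ℕ} (hP : 1 ≤ P) (hQ : 1 ≤ Q)
    (hsum : a + b + c + d + e + k = P + Q + 2)
    (hedge : a * d + b * e + c * d + c * e = P * Q + P + Q)
    (hminor : (a * b + a * c + b * c) * (d * e) = P * Q) :
    k = 0 ∧ ((a = 0 ∧ b = 1 ∧ d = 1 ∧ (c = P ∧ e = Q ∨ c = Q ∧ e = P)) ∨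
      (b = 0 ∧ a = 1 ∧ e = 1 ∧ (c = P ∧ d = Q ∨ c = Q ∧ d = P))) := by
  have hpos : 0 < P * Q := by positivity
  have hd : d ≠ 0 := by rintro rfl; simp at hminor; omega
  have he : e ≠ 0 := by rintro rfl; simp at hminor; omega
  rcases Nat.eq_zero_or_pos a with rfl | ha
  · have hb : b ≠ 0 := by rintro rfl; simp at hminor; omega
    have hc : c ≠ 0 := by rintro rfl; simp at hminor; omega
    obtain ⟨h1, h2, h3, h4⟩ := blowup_parameters_aux (P := P) (Q := Q) (k := k) hb hc hd he
      (by linarith) (by linarith) (by linarith)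
    exact ⟨h1, .inl ⟨rfl, h2, h3, h4⟩⟩
  rcases Nat.eq_zero_or_pos b with rfl | hb
  · have hc : c ≠ 0 := by rintro rfl; simp at hminor; omega
    obtain ⟨h1, h2, h3, h4⟩ := blowup_parameters_aux (P := P) (Q := Q) (k := k) ha.ne' hc he hd
      (by linarith) (by linarith) (by linarith)
    exact ⟨h1, .inr ⟨rfl, h2, h3, h4⟩⟩
  exfalso
  obtain ⟨a, rfl⟩ := Nat.exists_eq_add_of_lt ha
  obtain ⟨b, rfl⟩ := Nat.exists_eq_add_of_lt hb
  obtain ⟨d, rfl⟩ := Nat.exists_eq_succ_of_ne_zero hd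
  obtain ⟨e, rfl⟩ := Nat.exists_eq_succ_of_ne_zero he
  simp only [Nat.succ_eq_add_one] at *
  rcases Nat.eq_zero_or_pos c with rfl | hc
  · ring_nf at hsum hedge hminor
    lia
  · obtain ⟨c, rfl⟩ := Nat.exists_eq_add_of_lt hc
    ring_nf at hsum hedge hminor
    lia

lemma nonempty_iso_comap {ι V W : Type*} [DecidableEq ι] [Fintype V] [Fintype W]
    (P : SimpleGraph ι) (f : V → ι) (g : W → ι) (σ : Equiv.Perm ι)
    (hσ : ∀ u v, P.Adj (σ (f u)) (σ (f v)) ↔ P.Adj (f u) (f v))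
    (hcard : ∀ i, Fintype.card {w // g w = σ i} = Fintype.card {v // f v = i}) :
    Nonempty (P.comap f ≃g P.comap g) := by
  have hfib : ∀ i, Nonempty ({v // σ (f v) = i} ≃ {w // g w = i}) := by
    intro i
    rw [← Fintype.card_eq, ← σ.apply_symm_apply i, hcard]
    exact Fintype.card_congr (Equiv.subtypeEquivRight fun v => σ.apply_eq_iff_eq)
  let E := Equiv.ofFiberEquiv (f := σ ∘ f) (g := g) fun i => (hfib i).some
  have hE : ∀ v, g (E v) = σ (f v) := fun v => Equiv.ofFiberEquiv_map _ v
  exact ⟨⟨E, fun {u v} => by simp only [comap_adj, hE, hσ]⟩⟩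

/-- The classes of `K_{p,q}⁻` as a blow-up of the path on the vertices `1, 4, 2, 3`. -/
def kpqMinusClass (p q : ℕ) : Fin p ⊕ Fin q → Fin 6 :=
  Sum.elim (fun i => if i.val = 0 then 1 else 2) fun j => if j.val = 0 then 3 else 4

lemma KpqMinus_eq_comap (p q : ℕ) :
    KpqMinus p q = pathFiveIsolated.comap (kpqMinusClass p q) := by
  ext u v
  rcases u with i | i <;> rcases v with j | j <;> by_cases hi : i.val = 0 <;>
    by_cases hj : j.val = 0 <;> simp [KpqMinus, kpqMinusClass, pathFiveIsolated, hi, hj]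

lemma card_kpqMinusClass_eq (P Q : ℕ) (i : Fin 6) :
    Fintype.card {v // kpqMinusClass (P + 1) (Q + 1) v = i} = ![0, 1, P, 1, Q, 0] i := by
  rw [Fintype.card_subtype, Finset.card_filter, Fintype.sum_sum_type, Fin.sum_univ_succ,
    Fin.sum_univ_succ]
  fin_cases i <;> simp [kpqMinusClass]

/-- For all integers `p, q` with `2 ≤ p ≤ q`, the graph `K_{p,q}⁻` is
determined by its spectrum. -/
theorem KpqMinus_isDS (p q : ℕ) (hp : 2 ≤ p) (hpq : p ≤ q) :
    IsDS.{u} (KpqMinus p q) := by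
  intro W _ _ H hcos
  obtain ⟨P, rfl⟩ : ∃ P, p = P + 1 := ⟨p - 1, by omega⟩
  obtain ⟨Q, rfl⟩ : ∃ Q, q = Q + 1 := ⟨q - 1, by omega⟩
  have htr : ∀ k, (adjMat (KpqMinus (P + 1) (Q + 1)) ^ k).trace = (adjMat H ^ k).trace := by
    intro k
    rw [(adjMat_isHermitian _).trace_pow_eq_sum_roots, hcos,
      (adjMat_isHermitian _).trace_pow_eq_sum_roots]
  have hrank : (adjMat H).rank ≤ 4 := by
    rw [(adjMat_isHermitian _).rank_eq_card_roots, ← hcos,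
      ← (adjMat_isHermitian _).rank_eq_card_roots, KpqMinus_eq_comap, adjMat_comap]
    exact (rank_submatrix_le _ _ _).trans rank_adjMat_pathFiveIsolated
  have hcol : (KpqMinus (P + 1) (Q + 1)).Colorable 2 := by
    refine ⟨Coloring.mk (fun v => if v.isLeft then 0 else 1) fun {u v} h => ?_⟩
    rcases u with i | i <;> rcases v with j | j <;> simp [KpqMinus] at h ⊢
  have hcolH : H.Colorable 2 := by
    rw [colorable_two_iff_trace_adjMat_pow] at hcol ⊢
    exact fun k hk => (htr k).symm.trans (hcol k hk)
  have hvert : P + 1 + (Q + 1) = Fintype.card W := by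
    have := congrArg natDegree hcos
    simpa using this
  obtain ⟨f, rfl⟩ := exists_eq_comap_of_rank_le H hrank hcolH
  rw [KpqMinus_eq_comap] at htr ⊢
  obtain ⟨n, hn⟩ : ∃ n : Fin 6 → ℕ, ∀ i, Fintype.card {w // f w = i} = n i := ⟨_, fun _ => rfl⟩
  have hsum : n 0 + n 1 + n 2 + n 3 + n 4 + n 5 = P + Q + 2 := by
    have h := Fintype.card_congr (Equiv.sigmaFiberEquiv f)
    simp only [Fintype.card_sigma, hn, Fin.sum_univ_six] at h
    omega
  have h2 := htr 2
  have h4 := htr 4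
  rw [trace_adjMat_comap_sq _ _ (card_kpqMinusClass_eq P Q), trace_adjMat_comap_sq _ _ hn] at h2
  rw [trace_adjMat_comap_pow_four _ _ (card_kpqMinusClass_eq P Q),
    trace_adjMat_comap_pow_four _ _ hn] at h4
  have hedge := mul_left_cancel₀ two_ne_zero h2
  rw [hedge] at h4
  have hminor := mul_left_cancel₀ four_ne_zero (sub_right_injective h4)
  rw [Nat.cast_inj] at hedge hminor
  simp at hedge hminor
  obtain ⟨h5, h⟩ := blowup_parameters (P := P) (Q := Q) (by omega) (by omega) hsum
    (by linarith) (by linarith)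
  have key : ∀ σ : Equiv.Perm (Fin 6),
      (∀ i j, i ∈ [(1 : Fin 6), 2, 3, 4] → j ∈ [(1 : Fin 6), 2, 3, 4] →
        (pathFiveIsolated.Adj (σ i) (σ j) ↔ pathFiveIsolated.Adj i j)) →
      (∀ i, n (σ i) = ![0, 1, P, 1, Q, 0] i) →
      Nonempty (pathFiveIsolated.comap (kpqMinusClass (P + 1) (Q + 1)) ≃g
        pathFiveIsolated.comap f) := by
    intro σ hσ hnσ
    have hmem : ∀ v, kpqMinusClass (P + 1) (Q + 1) v ∈ [(1 : Fin 6), 2, 3, 4] := by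
      rintro (i | i) <;> simp only [kpqMinusClass, Sum.elim_inl, Sum.elim_inr] <;>
        split_ifs <;> decide
    refine nonempty_iso_comap _ _ _ σ (fun u v => hσ _ _ (hmem u) (hmem v)) fun i => ?_
    rw [hn, hnσ, card_kpqMinusClass_eq]
  rcases h with ⟨h0, h1, h3, ⟨hc, he⟩ | ⟨hc, he⟩⟩ | ⟨h1, h0, h4, ⟨hc, he⟩ | ⟨hc, he⟩⟩
  · refine key 1 (by decide) fun i => ?_
    fin_cases i <;> simp [*]
  · refine key (Equiv.swap 1 3 * Equiv.swap 2 4) (by decide) fun i => ?_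
    fin_cases i <;> simp [Equiv.swap_apply_def, *]
  · refine key (Equiv.swap 0 1 * Equiv.swap 3 4) (by decide) fun i => ?_
    fin_cases i <;> simp [Equiv.swap_apply_def, *]
  · refine key (Equiv.swap 0 1 * Equiv.swap 3 4 * (Equiv.swap 1 3 * Equiv.swap 2 4)) (by decide)
      fun i => ?_
    fin_cases i <;> simp [Equiv.swap_apply_def, *]
end

section
/- For every positive integer m, the graphs K_{m+2,4m+2}^+ and K_{2m+2,2m+3}^- ∪ mK_1 (the disjoint union of K_{2m+2,2m+3}^- with m isolated vertices) are cospectral but not isomorphic. -/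
open SimpleGraph Polynomial Matrix

universe u

/-- Square matrices of the same size that factor through the same smaller dimension have equal
characteristic polynomials as soon as the products in the reverse order do. -/
theorem charpoly_mul_eq_of_charpoly_mul_comm_eq {R n n' k : Type*} [CommRing R]
    [Fintype n] [DecidableEq n] [Fintype n'] [DecidableEq n'] [Fintype k] [DecidableEq k]
    (hcard : Fintype.card n = Fintype.card n')
    (A : Matrix n k R) (B : Matrix k n R) (A' : Matrix n' k R) (B' : Matrix k n' R)
    (h : (B * A).charpoly = (B' * A').charpoly) :
    (A * B).charpoly = (A' * B').charpoly := by
  have h₁ := Matrix.charpoly_mul_comm' A B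
  have h₂ := Matrix.charpoly_mul_comm' A' B'
  rw [h, hcard, ← h₂] at h₁
  exact (Polynomial.monic_X_pow (Fintype.card k)).isRegular.left h₁

/-- The vertex-by-class factor of the adjacency matrix of `K_{p,q}⁺`. -/
def plusFactor (p q : ℕ) : Matrix ((Fin p ⊕ Fin q) ⊕ Unit) (Fin 4) ℝ :=
  Matrix.of (Sum.elim (Sum.elim (fun i => ![1, 0, if i.val = 0 then 1 else 0, 0])
    (fun _ => ![0, 1, 0, 0])) (fun _ => ![0, 0, 0, 1]))

/-- The class-by-vertex factor of the adjacency matrix of `K_{p,q}⁺`. -/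
def plusCofactor (p q : ℕ) : Matrix (Fin 4) ((Fin p ⊕ Fin q) ⊕ Unit) ℝ :=
  (Matrix.of (Sum.elim (Sum.elim (fun i => ![0, 1, 0, if i.val = 0 then 1 else 0])
    (fun _ => ![1, 0, 0, 0])) (fun _ => ![0, 0, 1, 0])))ᵀ

theorem adjMat_KpqPlus (p q : ℕ) :
    adjMat (KpqPlus p q) = plusFactor p q * plusCofactor p q := by
  ext u v
  rcases u with (i | j) | _ <;> rcases v with (i' | j') | _ <;>
    simp [adjMat, KpqPlus, plusFactor, plusCofactor, Matrix.mul_apply, Fin.sum_univ_four]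

theorem plusCofactor_mul_plusFactor (p q : ℕ) :
    plusCofactor (p + 1) q * plusFactor (p + 1) q =
      !![0, (q : ℝ), 0, 0; (p : ℝ) + 1, 0, 1, 0; 0, 0, 0, 1; 1, 0, 1, 0] := by
  ext k l
  fin_cases k <;> fin_cases l <;>
    simp [plusFactor, plusCofactor, Matrix.mul_apply]

/-- The vertex-by-class factor of the adjacency matrix of `K_{p,q}⁻ ∪ mK₁`. -/
def minusFactor (p q m : ℕ) : Matrix ((Fin p ⊕ Fin q) ⊕ Fin m) (Fin 4) ℝ :=
  Matrix.of (Sum.elim (Sum.elim (fun i => ![1, 0, if i.val = 0 then -1 else 0, 0])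
    (fun j => ![0, 1, 0, if j.val = 0 then -1 else 0])) (fun _ => 0))

/-- The class-by-vertex factor of the adjacency matrix of `K_{p,q}⁻ ∪ mK₁`. -/
def minusCofactor (p q m : ℕ) : Matrix (Fin 4) ((Fin p ⊕ Fin q) ⊕ Fin m) ℝ :=
  (Matrix.of (Sum.elim (Sum.elim (fun i => ![0, 1, 0, if i.val = 0 then 1 else 0])
    (fun j => ![1, 0, if j.val = 0 then 1 else 0, 0])) (fun _ => 0)))ᵀ

theorem adjMat_addIsolated_KpqMinus (p q m : ℕ) :
    adjMat (addIsolated (KpqMinus p q) m) = minusFactor p q m * minusCofactor p q m := by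
  ext u v
  rcases u with (i | j) | _ <;> rcases v with (i' | j') | _ <;>
    simp [adjMat, addIsolated, KpqMinus, minusFactor, minusCofactor, Matrix.mul_apply,
      Fin.sum_univ_four]
  all_goals split_ifs <;> simp_all

theorem minusCofactor_mul_minusFactor (p q m : ℕ) :
    minusCofactor (p + 1) (q + 1) m * minusFactor (p + 1) (q + 1) m =
      !![0, (q : ℝ) + 1, 0, -1; (p : ℝ) + 1, 0, -1, 0; 0, 1, 0, -1; 1, 0, -1, 0] := by
  ext k l
  fin_cases k <;> fin_cases l <;>
    simp [minusFactor, minusCofactor, Matrix.mul_apply]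

theorem KpqPlus_exists_adj (p q : ℕ) (v : (Fin (p + 1) ⊕ Fin (q + 1)) ⊕ Unit) :
    ∃ w, (KpqPlus (p + 1) (q + 1)).Adj v w := by
  rcases v with (i | j) | _
  · exact ⟨Sum.inl (Sum.inr 0), by simp [KpqPlus]⟩
  · exact ⟨Sum.inl (Sum.inl 0), by simp [KpqPlus]⟩
  · exact ⟨Sum.inl (Sum.inl 0), by simp [KpqPlus]⟩

theorem not_addIsolated_adj_inr {V : Type*} (G : SimpleGraph V) (m : ℕ) (k : Fin m)
    (w : V ⊕ Fin m) : ¬(addIsolated G m).Adj (Sum.inr k) w := by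
  simp [addIsolated]

/-- For every positive integer `m`, the graphs `K_{m+2,4m+2}⁺` and
`K_{2m+2,2m+3}⁻ ∪ mK₁` are cospectral but not isomorphic. -/
theorem KpqPlus_cospectral_not_iso (m : ℕ) (hm : 1 ≤ m) :
    Cospectral (KpqPlus (m + 2) (4 * m + 2)) (addIsolated (KpqMinus (2 * m + 2) (2 * m + 3)) m) ∧
    IsEmpty (KpqPlus (m + 2) (4 * m + 2) ≃g addIsolated (KpqMinus (2 * m + 2) (2 * m + 3)) m) := by
  constructor
  · unfold Cospectral
    rw [adjMat_KpqPlus, adjMat_addIsolated_KpqMinus]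
    apply charpoly_mul_eq_of_charpoly_mul_comm_eq
    · simp
      ring
    · rw [plusCofactor_mul_plusFactor, minusCofactor_mul_minusFactor]
      simp [Matrix.charpoly, Matrix.charmatrix, Matrix.det_succ_row_zero, Fin.sum_univ_succ,
        Fin.succAbove]
      have h_two : (C 2 : ℝ[X]) = 2 := rfl
      have h_four : (C 4 : ℝ[X]) = 4 := rfl
      rw [h_two, h_four]
      ring
  · refine ⟨fun e => ?_⟩
    obtain ⟨w, hw⟩ := KpqPlus_exists_adj (m + 1) (4 * m + 1) (e.symm (Sum.inr ⟨0, hm⟩))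
    have h := e.map_adj_iff.mpr hw
    rw [e.apply_symm_apply] at h
    exact not_addIsolated_adj_inr _ _ _ _ h
end
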